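/- For all probability measures μ, ν on E_{n-1} and every x_n ∈ S_n, the one-step kernels satisfy ‖K_{n,μ}(x_n, ·) − K_{n,ν}(x_n, ·)‖_tv ≤ 2 ‖μ − ν‖_tv. -/

import Mathlib

open MeasureTheory
open scoped ENNReal NNReal

namespace Paper

noncomputable section

/-- Total variation distance: `sup {|∫ f dμ - ∫ f dν| : f measurable, |f| ≤ 1}`. -/
def tvDist {Z : Type*} [MeasurableSpace Z] (μ ν : Measure Z) : ℝ :=
  ⨆ f : { f : Z → ℝ // Measurable f ∧ ∀ z, |f z| ≤ 1 },
    |(∫ z, f.1 z ∂μ) - ∫ z, f.1 z ∂ν|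

/-- `m`-step iterate of a kernel. -/
def iterK {Z : Type*} [MeasurableSpace Z] (K : Z → Measure Z) : ℕ → Z → Measure Z
  | 0 => fun z => Measure.dirac z
  | m + 1 => fun z => (iterK K m z).bind K

/-- Solution of the Poisson equation associated to `K` and `ω`. -/
def poissonSol {Z : Type*} [MeasurableSpace Z] (K : Z → Measure Z) (ω : Measure Z)
    (f : Z → ℝ) (z : Z) : ℝ :=
  ∑' i : ℕ, ((∫ y, f y ∂(iterK K i z)) - ∫ y, f y ∂ω)

/-- `(δ_{z0} - ω') K'^i (K' - K) K^j (g)`, composed from left to right. -/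
def crossTerm {Z : Type*} [MeasurableSpace Z] (K K' : Z → Measure Z) (ω' : Measure Z)
    (g : Z → ℝ) (z0 : Z) (i j : ℕ) : ℝ :=
  (∫ y, ((∫ a, (∫ b, g b ∂(iterK K j a)) ∂(K' y)) -
      ∫ a, (∫ b, g b ∂(iterK K j a)) ∂(K y)) ∂(iterK K' i z0)) -
    ∫ z, (∫ y, ((∫ a, (∫ b, g b ∂(iterK K j a)) ∂(K' y)) -
      ∫ a, (∫ b, g b ∂(iterK K j a)) ∂(K y)) ∂(iterK K' i z)) ∂ω'

variable {X Y : Type*} [MeasurableSpace X] [MeasurableSpace Y]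

/-- The importance weight `w_n`. -/
def weight (γm : X → ℝ≥0∞) (γn q : X × Y → ℝ≥0∞) (p : X × Y) : ℝ≥0∞ :=
  γn p / (γm p.1 * q p)

/-- The Metropolis–Hastings acceptance probability. -/
def accept (w : X × Y → ℝ≥0∞) (p p' : X × Y) : ℝ≥0∞ := min 1 (w p' / w p)

/-- The proposal distribution `μ × q_n`. -/
def proposal (dxY : Measure Y) (q : X × Y → ℝ≥0∞) (μ : Measure X) : Measure (X × Y) :=
  (μ.prod dxY).withDensity q

/-- The Metropolis–Hastings kernel `K_{n,μ}`. -/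
def mhK (dxY : Measure Y) (γm : X → ℝ≥0∞) (γn q : X × Y → ℝ≥0∞) (μ : Measure X)
    (p : X × Y) : Measure (X × Y) :=
  (proposal dxY q μ).withDensity (accept (weight γm γn q) p) +
    (1 - ∫⁻ p', accept (weight γm γn q) p p' ∂(proposal dxY q μ)) • Measure.dirac p

/-- The marginal density `π_n(x_{n-1})`. -/
def margN (dxY : Measure Y) (γn : X × Y → ℝ≥0∞) (Zn : ℝ≥0∞) (x : X) : ℝ≥0∞ :=
  (∫⁻ y, γn (x, y) ∂dxY) / Zn

/-- The ratio `π_{n/n-1}(x_{n-1}) = π_n(x_{n-1}) / π_{n-1}(x_{n-1})`. -/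
def ratioN (dxY : Measure Y) (γm : X → ℝ≥0∞) (γn : X × Y → ℝ≥0∞) (Zm Zn : ℝ≥0∞)
    (x : X) : ℝ≥0∞ :=
  margN dxY γn Zn x / (γm x / Zm)

/-- The conditional density `π̄_n(x_{n-1}, x)`. -/
def condN (dxY : Measure Y) (γn : X × Y → ℝ≥0∞) (Zn : ℝ≥0∞) (p : X × Y) : ℝ≥0∞ :=
  (γn p / Zn) / margN dxY γn Zn p.1

/-- The invariant distribution `ω_n(μ)`. -/
def omegaN (dxY : Measure Y) (γm : X → ℝ≥0∞) (γn : X × Y → ℝ≥0∞) (Zm Zn : ℝ≥0∞)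
    (μ : Measure X) : Measure (X × Y) :=
  (∫⁻ x, ratioN dxY γm γn Zm Zn x ∂μ)⁻¹ •
    (μ.prod dxY).withDensity fun p => ratioN dxY γm γn Zm Zn p.1 * condN dxY γn Zn p

/-- Differences of integrals of a test function bounded by `c` are at most `c` times the total
variation distance. -/
theorem abs_integral_sub_le_mul_tvDist {Z : Type*} [MeasurableSpace Z] (μ ν : Measure Z)
    [IsProbabilityMeasure μ] [IsProbabilityMeasure ν] {g : Z → ℝ} (hg : Measurable g)
    {c : ℝ} (hc : 0 < c) (hgc : ∀ z, |g z| ≤ c) :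
    |(∫ z, g z ∂μ) - ∫ z, g z ∂ν| ≤ c * tvDist μ ν := by
  have hbdd : BddAbove (Set.range fun f : { f : Z → ℝ // Measurable f ∧ ∀ z, |f z| ≤ 1 } =>
      |(∫ z, f.1 z ∂μ) - ∫ z, f.1 z ∂ν|) := by
    refine ⟨2, ?_⟩
    rintro _ ⟨f, rfl⟩
    have hbound : ∀ (ρ : Measure Z) [IsProbabilityMeasure ρ], |∫ z, f.1 z ∂ρ| ≤ 1 := by
      intro ρ _
      have h := norm_integral_le_of_norm_le_const (μ := ρ) (f := f.1) (C := 1)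
        (.of_forall fun z => f.2.2 z)
      simpa using h
    have h := abs_sub (∫ z, f.1 z ∂μ) (∫ z, f.1 z ∂ν)
    have hμ := hbound μ
    have hν := hbound ν
    simp only
    linarith
  have hscaled : Measurable (fun z => g z / c) ∧ ∀ z, |g z / c| ≤ 1 := by
    refine ⟨hg.div_const c, fun z => ?_⟩
    rw [abs_div, abs_of_pos hc]
    exact div_le_one_of_le₀ (hgc z) hc.le
  have h := le_ciSup hbdd ⟨fun z => g z / c, hscaled⟩
  simp only [integral_div] at h
  rw [← sub_div, abs_div, abs_of_pos hc, div_le_iff₀ hc] at h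
  rw [mul_comm]
  exact h

theorem measurable_accept {w : X × Y → ℝ≥0∞} (hw : Measurable w) (p : X × Y) :
    Measurable (accept w p) :=
  measurable_const.min (hw.div_const _)

theorem measurable_weight {γm : X → ℝ≥0∞} {γn q : X × Y → ℝ≥0∞} (hγm : Measurable γm)
    (hγn : Measurable γn) (hq : Measurable q) : Measurable (weight γm γn q) :=
  hγn.div ((hγm.comp measurable_fst).mul hq)

theorem isProbabilityMeasure_proposal (dxY : Measure Y) [SFinite dxY] {q : X × Y → ℝ≥0∞}
    (hq : Measurable q) (hqdens : ∀ x, ∫⁻ y, q (x, y) ∂dxY = 1)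
    (μ : Measure X) [IsProbabilityMeasure μ] : IsProbabilityMeasure (proposal dxY q μ) := by
  refine ⟨?_⟩
  rw [proposal, withDensity_apply _ .univ, Measure.restrict_univ, lintegral_prod _ hq.aemeasurable]
  simp [hqdens]

/-- Disintegration of bounded integrals against the proposal distribution. -/
theorem integral_proposal (dxY : Measure Y) [SFinite dxY] {q : X × Y → ℝ≥0∞}
    (hq : Measurable q) (hqfin : ∀ p, q p ≠ ⊤) (hqdens : ∀ x, ∫⁻ y, q (x, y) ∂dxY = 1)
    (μ : Measure X) [IsProbabilityMeasure μ] {F : X × Y → ℝ} (hF : Measurable F) {c : ℝ}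
    (hFc : ∀ p, |F p| ≤ c) :
    ∫ p, F p ∂(proposal dxY q μ) = ∫ x, ∫ y, (q (x, y)).toReal * F (x, y) ∂dxY ∂μ := by
  have := isProbabilityMeasure_proposal dxY hq hqdens μ
  have hint : Integrable F (proposal dxY q μ) :=
    .of_bound hF.aestronglyMeasurable c (.of_forall hFc)
  have hlt : ∀ᵐ p ∂(μ.prod dxY), q p < ⊤ := .of_forall fun p => (hqfin p).lt_top
  rw [proposal] at hint ⊢
  rw [integrable_withDensity_iff_integrable_smul' hq hlt] at hint
  rw [integral_withDensity_eq_integral_toReal_smul hq hlt, integral_prod _ hint]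
  simp only [smul_eq_mul]

theorem abs_integral_density_mul_le (dxY : Measure Y) {r : Y → ℝ≥0∞}
    (hr : Measurable r) (hrfin : ∀ y, r y ≠ ⊤) (hrdens : ∫⁻ y, r y ∂dxY = 1)
    {g : Y → ℝ} {c : ℝ} (hgc : ∀ y, |g y| ≤ c) :
    |∫ y, (r y).toReal * g y ∂dxY| ≤ c := by
  have : IsProbabilityMeasure (dxY.withDensity r) := ⟨by simp [hrdens]⟩
  have h := norm_integral_le_of_norm_le_const (μ := dxY.withDensity r) (f := g) (C := c)
    (.of_forall hgc)
  rw [integral_withDensity_eq_integral_toReal_smul hr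
    (.of_forall fun y => (hrfin y).lt_top)] at h
  simpa using h

/-- Integrals against the Metropolis–Hastings kernel, written as the value at the current state
plus the expected accepted increment. -/
theorem integral_mhK (dxY : Measure Y) [SFinite dxY] {γm : X → ℝ≥0∞} {γn q : X × Y → ℝ≥0∞}
    (hγm : Measurable γm) (hγn : Measurable γn) (hq : Measurable q)
    (hqdens : ∀ x, ∫⁻ y, q (x, y) ∂dxY = 1) (μ : Measure X) [IsProbabilityMeasure μ]
    (p : X × Y) {f : X × Y → ℝ} (hf : Measurable f) (hf1 : ∀ p', |f p'| ≤ 1) :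
    ∫ p', f p' ∂(mhK dxY γm γn q μ p) =
      f p + ∫ p', (accept (weight γm γn q) p p').toReal * (f p' - f p) ∂(proposal dxY q μ) := by
  have := isProbabilityMeasure_proposal dxY hq hqdens μ
  set Q := proposal dxY q μ with hQ
  set a := accept (weight γm γn q) p with ha
  have ha1 : ∀ p', a p' ≤ 1 := fun _ => min_le_left _ _
  have ham : Measurable a := measurable_accept (measurable_weight hγm hγn hq) p
  have halt : ∀ᵐ p' ∂Q, a p' < ⊤ := .of_forall fun p' => (ha1 p').trans_lt ENNReal.one_lt_top
  have har : ∀ p', ‖(a p').toReal‖ ≤ 1 := fun p' => by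
    rw [Real.norm_of_nonneg ENNReal.toReal_nonneg]
    exact ENNReal.toReal_mono ENNReal.one_ne_top (ha1 p')
  have haint : Integrable (fun p' => (a p').toReal) Q :=
    .of_bound ham.ennreal_toReal.aestronglyMeasurable 1 (.of_forall har)
  have hfint : ∀ (ρ : Measure (X × Y)) [IsFiniteMeasure ρ], Integrable f ρ := fun ρ _ =>
    .of_bound hf.aestronglyMeasurable 1 (.of_forall hf1)
  have hafint : Integrable (fun p' => (a p').toReal * f p') Q :=
    (hfint Q).bdd_mul ham.ennreal_toReal.aestronglyMeasurable (.of_forall har)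
  have hmass : ∫⁻ p', a p' ∂Q ≤ 1 := by
    calc ∫⁻ p', a p' ∂Q ≤ ∫⁻ _, 1 ∂Q := lintegral_mono ha1
      _ = 1 := by simp
  have hfin : IsFiniteMeasure (Q.withDensity a) :=
    isFiniteMeasure_withDensity (hmass.trans_lt ENNReal.one_lt_top).ne
  have hrej : 1 - ∫⁻ p', a p' ∂Q ≠ ⊤ := (tsub_le_self.trans_lt ENNReal.one_lt_top).ne
  rw [mhK, ← hQ, ← ha, integral_add_measure (hfint _) ((hfint _).smul_measure hrej),
    integral_smul_measure, integral_dirac' _ _ hf.stronglyMeasurable,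
    integral_withDensity_eq_integral_toReal_smul ham halt,
    ENNReal.toReal_sub_of_le hmass ENNReal.one_ne_top, ENNReal.toReal_one,
    ← integral_toReal ham.aemeasurable halt]
  simp only [smul_eq_mul, mul_sub]
  rw [integral_sub hafint (haint.mul_const _), integral_mul_const]
  ring

theorem statement5
    (dxm : Measure X) [SigmaFinite dxm] (dxY : Measure Y) [SigmaFinite dxY]
    (γm : X → ℝ≥0∞) (γn q : X × Y → ℝ≥0∞)
    (hγm : Measurable γm) (hγmfin : ∀ x, γm x ≠ ⊤)
    (hγn : Measurable γn) (hγnfin : ∀ p, γn p ≠ ⊤)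
    (Zm Zn : ℝ≥0∞)
    (hZm : Zm = ∫⁻ x, γm x ∂dxm) (hZm0 : 0 < Zm) (hZmt : Zm ≠ ⊤)
    (hZn : Zn = ∫⁻ p, γn p ∂(dxm.prod dxY)) (hZn0 : 0 < Zn) (hZnt : Zn ≠ ⊤)
    (hq : Measurable q) (hqpos : ∀ p, 0 < q p) (hqfin : ∀ p, q p ≠ ⊤)
    (hqdens : ∀ x, ∫⁻ y, q (x, y) ∂dxY = 1)
    :
    ∀ μ ν : Measure X, IsProbabilityMeasure μ → IsProbabilityMeasure ν →
      ∀ p : X × Y, 0 < γn p / Zn →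
        tvDist (mhK dxY γm γn q μ p) (mhK dxY γm γn q ν p) ≤ 2 * tvDist μ ν := by
  intro μ ν hμ hν p _
  have : Nonempty { f : X × Y → ℝ // Measurable f ∧ ∀ z, |f z| ≤ 1 } :=
    ⟨⟨fun _ => 0, measurable_const, by simp⟩⟩
  refine ciSup_le fun ⟨f, hf, hf1⟩ => ?_
  set a := accept (weight γm γn q) p
  have ham : Measurable a := measurable_accept (measurable_weight hγm hγn hq) p
  have hFm : Measurable fun p' => (a p').toReal * (f p' - f p) :=
    ham.ennreal_toReal.mul (hf.sub_const _)
  have hF2 : ∀ p', |(a p').toReal * (f p' - f p)| ≤ 2 := fun p' => by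
    have h1 : (a p').toReal ≤ 1 := ENNReal.toReal_mono ENNReal.one_ne_top (min_le_left _ _)
    have h2 : |f p' - f p| ≤ 2 := by
      linarith [abs_sub (f p') (f p), hf1 p', hf1 p]
    rw [abs_mul, abs_of_nonneg ENNReal.toReal_nonneg]
    nlinarith [abs_nonneg (f p' - f p)]
  simp only [integral_mhK dxY hγm hγn hq hqdens _ p hf hf1, add_sub_add_left_eq_sub]
  rw [integral_proposal dxY hq hqfin hqdens μ hFm hF2,
    integral_proposal dxY hq hqfin hqdens ν hFm hF2]
  refine abs_integral_sub_le_mul_tvDist μ ν ?_ two_pos fun x => ?_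
  · exact ((hq.ennreal_toReal.mul hFm).stronglyMeasurable.integral_prod_right').measurable
  · exact abs_integral_density_mul_le dxY (hq.comp measurable_prodMk_left)
      (fun y => hqfin (x, y)) (hqdens x) fun y => hF2 (x, y)

end

end Paper
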